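/- Fix an integer n ≥ 1 and let Ẑ ∈ M^<_n contain a copy of the complete graph on n vertices. Then there exists T̂ ∈ M^<_n such that for every proper coloring λ : T̂ → {1,…,n} of the underlying graph of T̂, there is a copy Z̃ of Ẑ in T̂ and a permutation f of {1,…,n} such that λ = f ∘ λ^Z̃ on the vertex set of Z̃, where λ^Z̃ is the built-in coloring of the copy Z̃. -/

import Mathlib

/-- `f` is an embedding of ordered graphs (vertex sets `Fin a`, `Fin c` with their
natural linear orders): strictly increasing, preserving and reflecting adjacency. -/
def OrdEmb {a c : ℕ} (X : SimpleGraph (Fin a)) (Z : SimpleGraph (Fin c))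
    (f : Fin a → Fin c) : Prop :=
  StrictMono f ∧ ∀ i j, Z.Adj (f i) (f j) ↔ X.Adj i j

/-- `lam` is a proper coloring of `X` with colors in `Fin n`. -/
def ProperCol {a n : ℕ} (X : SimpleGraph (Fin a)) (lam : Fin a → Fin n) : Prop :=
  ∀ i j, X.Adj i j → lam i ≠ lam j

/-- `f` is an embedding of ordered `[n]`-colored graphs: an ordered-graph embedding
that also preserves the vertex colorings. -/
def ColOrdEmb {n a c : ℕ} (X : SimpleGraph (Fin a)) (lamX : Fin a → Fin n)
    (Z : SimpleGraph (Fin c)) (lamZ : Fin c → Fin n) (f : Fin a → Fin c) : Prop :=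
  OrdEmb X Z f ∧ ∀ i, lamZ (f i) = lamX i

/-- `S` is the vertex set of an induced copy of the (unordered) graph `X` in `Z`. -/
def IsCopy {a c : ℕ} (X : SimpleGraph (Fin a)) (Z : SimpleGraph (Fin c))
    (S : Finset (Fin c)) : Prop :=
  ∃ f : Fin a → Fin c, Function.Injective f ∧
    (∀ i j, Z.Adj (f i) (f j) ↔ X.Adj i j) ∧ Finset.image f Finset.univ = S

theorem ColOrdEmb.comp {n a b c : ℕ} {X : SimpleGraph (Fin a)} {Y : SimpleGraph (Fin b)}
    {Z : SimpleGraph (Fin c)} {lamX : Fin a → Fin n} {lamY : Fin b → Fin n} {lamZ : Fin c → Fin n}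
    {g : Fin b → Fin c} {f : Fin a → Fin b}
    (hg : ColOrdEmb Y lamY Z lamZ g) (hf : ColOrdEmb X lamX Y lamY f) :
    ColOrdEmb X lamX Z lamZ (g ∘ f) :=
  ⟨⟨hg.1.1.comp hf.1.1, fun i j => (hg.1.2 _ _).trans (hf.1.2 i j)⟩,
    fun i => (hg.2 _).trans (hf.2 i)⟩

theorem ColOrdEmb.id {n a : ℕ} (X : SimpleGraph (Fin a)) (lamX : Fin a → Fin n) :
    ColOrdEmb X lamX X lamX id :=
  ⟨⟨strictMono_id, fun _ _ => Iff.rfl⟩, fun _ => rfl⟩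

/-- The amalgam of copies of `(Z, lamZ)` along a family of injective colour-preserving maps `e s`
is a properly coloured graph containing each copy as an induced one, as soon as any two edges
with the same endpoints come from the same member of the family. -/
theorem exists_amalgam {n b c : ℕ} {ι : Type*} (Z : SimpleGraph (Fin b)) (lamZ : Fin b → Fin n)
    (hZ : ProperCol Z lamZ) (lamT : Fin c → Fin n) (e : ι → Fin b → Fin c)
    (hmono : ∀ s, StrictMono (e s)) (hcol : ∀ s x, lamT (e s x) = lamZ x)
    (hedge : ∀ s t x y x' y', Z.Adj x' y' → e s x = e t x' → e s y = e t y' → s = t) :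
    ∃ T : SimpleGraph (Fin c), ProperCol T lamT ∧ ∀ s, ColOrdEmb Z lamZ T lamT (e s) := by
  refine ⟨⟨fun p q => ∃ s x y, Z.Adj x y ∧ e s x = p ∧ e s y = q, ⟨?_⟩, ⟨?_⟩⟩, ?_, ?_⟩
  · rintro p q ⟨s, x, y, h, hp, hq⟩
    exact ⟨s, y, x, h.symm, hq, hp⟩
  · rintro p ⟨s, x, y, h, hp, hq⟩
    exact h.ne ((hmono s).injective (hp.trans hq.symm))
  · rintro p q ⟨s, x, y, h, rfl, rfl⟩
    rw [hcol, hcol]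
    exact hZ x y h
  · refine fun s => ⟨⟨hmono s, fun x y => ⟨?_, fun h => ⟨s, x, y, h, rfl, rfl⟩⟩⟩, hcol s⟩
    rintro ⟨t, x', y', h, hx, hy⟩
    obtain rfl := hedge s t x y x' y' h hx.symm hy.symm
    rwa [(hmono s).injective hx, (hmono s).injective hy] at h

/-- Every map from `Fin (n * b)` to `n` colours is constant on some `b`-element subset. -/
theorem exists_orderEmbedding_monochromatic {n : ℕ} (hn : 1 ≤ n) (b : ℕ)
    (f : Fin (n * b) → Fin n) :
    ∃ s : Fin b ↪o Fin (n * b), ∀ x y, f (s x) = f (s y) := by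
  have : Nonempty (Fin n) := ⟨⟨0, hn⟩⟩
  obtain ⟨k, hk⟩ := Fintype.exists_le_card_fiber_of_mul_le_card (n := b) f (by simp)
  refine ⟨Finset.orderEmbOfCardLe _ hk, fun x y => ?_⟩
  have h := fun z => (Finset.mem_filter.1 (Finset.orderEmbOfCardLe_mem _ hk z)).2
  rw [h x, h y]

/-- There is a monotone `T` such that every vertex colouring of `T` is constant on the colour
class `i` of some copy of `Z`. -/
theorem exists_monochromatic_class {n : ℕ} (hn : 1 ≤ n) {b : ℕ}
    (Z : SimpleGraph (Fin b)) (lamZ : Fin b → Fin n)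
    (hZ : ProperCol Z lamZ) (hZm : Monotone lamZ) (i : Fin n) :
    ∃ (c : ℕ) (T : SimpleGraph (Fin c)) (lamT : Fin c → Fin n),
      ProperCol T lamT ∧ Monotone lamT ∧
      ∀ lam : Fin c → Fin n, ∃ e : Fin b → Fin c, ColOrdEmb Z lamZ T lamT e ∧
        ∀ x y, lamZ x = i → lamZ y = i → lam (e x) = lam (e y) := by
  classical
  have hb : b ≤ n * b := Nat.le_mul_of_pos_left b hn
  let idx := Finite.equivFin (Fin b ↪o Fin (n * b))
  let V := Fin n ×ₗ (Fin (Nat.card (Fin b ↪o Fin (n * b)) + 1) ×ₗ Fin (n * b))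
  let _ : Fintype V := Fintype.ofFinite V
  let φ : Fin (Fintype.card V) ≃o V := Fintype.orderIsoFinOfCardEq V rfl
  let v : (Fin b ↪o Fin (n * b)) → Fin b → V := fun s x =>
    if lamZ x = i then toLex (i, toLex (0, s x))
    else toLex (lamZ x, toLex ((idx s).succ, Fin.castLE hb x))
  have hcol : ∀ s x, (ofLex (v s x)).1 = lamZ x := by
    intro s x
    by_cases h : lamZ x = i <;> simp [v, h]
  have hmono : ∀ s, StrictMono (v s) := by
    intro s x y hxy
    rcases (hZm hxy.le).lt_or_eq with h | h
    · refine Prod.Lex.lt_iff.2 (Or.inl ?_)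
      rwa [hcol, hcol]
    · have hlex : ∀ (j : Fin n) (k : Fin (Nat.card (Fin b ↪o Fin (n * b)) + 1))
          (p q : Fin (n * b)), p < q → (toLex (j, toLex (k, p)) : V) < toLex (j, toLex (k, q)) :=
        fun j k p q hpq => Prod.Lex.lt_iff.2 (Or.inr ⟨rfl, Prod.Lex.lt_iff.2 (Or.inr ⟨rfl, hpq⟩)⟩)
      by_cases hx : lamZ x = i
      · simpa only [v, hx, ← h, if_true] using hlex i 0 _ _ (s.strictMono hxy)
      · simpa only [v, hx, ← h, if_false] using
          hlex (lamZ x) (idx s).succ _ _ (Fin.strictMono_castLE hb hxy)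
  have hinj : ∀ s t x x', lamZ x ≠ i → v s x = v t x' → s = t := by
    intro s t x x' hx h
    have hc : lamZ x' = lamZ x := by rw [← hcol t, ← hcol s, h]
    simp only [v, hc, hx, if_false] at h
    have h2 := congrArg (fun p => (ofLex (ofLex p).2).1) h
    exact idx.injective (Fin.succ_injective _ h2)
  obtain ⟨T, hT, hTe⟩ := exists_amalgam Z lamZ hZ (fun p => (ofLex (φ p)).1)
    (fun s x => φ.symm (v s x)) (fun s => φ.symm.strictMono.comp (hmono s))
    (fun s x => by simp [hcol]) (by
      intro s t x y x' y' h hx hy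
      have hx := φ.symm.injective hx
      have hy := φ.symm.injective hy
      have hc : lamZ x ≠ lamZ y := by
        rw [← hcol s x, ← hcol s y, hx, hy, hcol, hcol]
        exact hZ x' y' h
      by_cases hi : lamZ x = i
      · exact hinj s t y y' (fun h' => hc (hi.trans h'.symm)) hy
      · exact hinj s t x x' hi hx)
  refine ⟨_, T, _, hT, fun p q hpq => ?_, fun lam => ?_⟩
  · exact Prod.Lex.monotone_fst _ _ (φ.monotone hpq)
  · obtain ⟨s, hs⟩ := exists_orderEmbedding_monochromatic hn b
      (fun k => lam (φ.symm (toLex (i, toLex (0, k)))))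
    refine ⟨_, hTe s, fun x y hx hy => ?_⟩
    simpa [v, hx, hy] using hs x y

/-- There is a monotone `T` such that every vertex colouring of `T` is constant on each of the
colour classes in `s` of some copy of `Z`. -/
theorem exists_monochromatic_classes {n : ℕ} (hn : 1 ≤ n) (s : Finset (Fin n)) {b : ℕ}
    (Z : SimpleGraph (Fin b)) (lamZ : Fin b → Fin n)
    (hZ : ProperCol Z lamZ) (hZm : Monotone lamZ) :
    ∃ (c : ℕ) (T : SimpleGraph (Fin c)) (lamT : Fin c → Fin n),
      ProperCol T lamT ∧ Monotone lamT ∧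
      ∀ lam : Fin c → Fin n, ∃ e : Fin b → Fin c, ColOrdEmb Z lamZ T lamT e ∧
        ∀ i ∈ s, ∀ x y, lamZ x = i → lamZ y = i → lam (e x) = lam (e y) := by
  classical
  induction s using Finset.induction_on generalizing b with
  | empty => exact ⟨b, Z, lamZ, hZ, hZm, fun _ => ⟨id, ColOrdEmb.id Z lamZ, by simp⟩⟩
  | insert i s _ ih =>
    obtain ⟨c, Y, lamY, hY, hYm, hYe⟩ := exists_monochromatic_class hn Z lamZ hZ hZm i
    obtain ⟨d, T, lamT, hT, hTm, hTe⟩ := ih Y lamY hY hYm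
    refine ⟨d, T, lamT, hT, hTm, fun lam => ?_⟩
    obtain ⟨g, hg, hgs⟩ := hTe lam
    obtain ⟨f, hf, hfi⟩ := hYe (lam ∘ g)
    refine ⟨g ∘ f, hg.comp hf, fun j hj x y hx hy => ?_⟩
    rcases Finset.mem_insert.1 hj with rfl | hj
    · exact hfi x y hx hy
    · exact hgs j hj _ _ ((hf.2 x).trans hx) ((hf.2 y).trans hy)

/-- if `(Z, lamZ) ∈ M^<_n` contains a copy of the complete graph on
`n` vertices, there is `(T, lamT) ∈ M^<_n` such that for every proper
`[n]`-coloring `lam` of `T` there is a copy of `(Z, lamZ)` in `(T, lamT)` on which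
`lam` agrees with `f ∘ lamZ` for some permutation `f` of the colors. -/
theorem stmt_17 (n : ℕ) (hn : 1 ≤ n) (b : ℕ)
    (Z : SimpleGraph (Fin b)) (lamZ : Fin b → Fin n)
    (hZ : ProperCol Z lamZ) (hZm : Monotone lamZ)
    (hK : ∃ g : Fin n → Fin b, Function.Injective g ∧
      ∀ i j, i ≠ j → Z.Adj (g i) (g j)) :
    ∃ (c : ℕ) (T : SimpleGraph (Fin c)) (lamT : Fin c → Fin n),
      ProperCol T lamT ∧ Monotone lamT ∧
      ∀ lam : Fin c → Fin n, ProperCol T lam →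
        ∃ (e : Fin b → Fin c) (f : Equiv.Perm (Fin n)),
          ColOrdEmb Z lamZ T lamT e ∧ ∀ i, lam (e i) = f (lamZ i) := by
  obtain ⟨c, T, lamT, hT, hTm, hTe⟩ :=
    exists_monochromatic_classes hn Finset.univ Z lamZ hZ hZm
  refine ⟨c, T, lamT, hT, hTm, fun lam hlam => ?_⟩
  obtain ⟨e, he, hc⟩ := hTe lam
  obtain ⟨g, -, hg⟩ := hK
  have hbij : Function.Bijective (lamZ ∘ g) := Finite.injective_iff_bijective.1 fun x y h => by
    by_contra hxy
    exact hZ _ _ (hg x y hxy) h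
  have hbij' : Function.Bijective (lam ∘ e ∘ g) := Finite.injective_iff_bijective.1 fun x y h => by
    by_contra hxy
    exact hlam _ _ ((he.1.2 _ _).2 (hg x y hxy)) h
  let p := Equiv.ofBijective _ hbij
  refine ⟨e, p.symm.trans (Equiv.ofBijective _ hbij'), he, fun x => ?_⟩
  exact hc (lamZ x) (Finset.mem_univ _) x (g (p.symm (lamZ x))) rfl (p.apply_symm_apply (lamZ x))
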